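/- arXiv:2007.16178 — 2 statements merged into one kernel-verified Lean document; each statement's English description precedes it below -/
import Mathlib

section
/- If H > 1/2, then the Cameron–Martin space H̄ is continuously embedded in C_0^H([0,1]; ℝ^d), the space of H-Hölder continuous paths started at 0. If H ≤ 1/2, then for any q > (H + 1/2)^{-1}, H̄ is continuously embedded in C_0^{q-var}([0,1]; ℝ^d), the space of continuous paths started at 0 with finite q-variation. -/
open MeasureTheory Real Set
open scoped RealInnerProductSpace

noncomputable section

/-- Covariance function of fractional Brownian motion with Hurst parameter `H`. -/
def fbmCov (H s t : ℝ) : ℝ := (1 / 2) * (s ^ (2 * H) + t ^ (2 * H) - |s - t| ^ (2 * H))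

/-- A telescoping sum over `Fin n`. -/
lemma sum_fin_succ_sub_castSucc {M : Type*} [AddCommGroup M] {n : ℕ} (f : Fin (n + 1) → M) :
    ∑ k : Fin n, (f k.succ - f k.castSucc) = f (Fin.last n) - f 0 := by
  have h := (Fin.sum_univ_succ f).symm.trans (Fin.sum_univ_castSucc f)
  rw [Finset.sum_sub_distrib, sub_eq_sub_iff_add_eq_add, add_comm, h, add_comm]

/-- A diagonal bound for the Gram matrix of vectors that are pairwise negatively correlated, but
nonnegatively correlated with their sum. -/
lemma norm_sq_sum_smul_le {E ι : Type*} [NormedAddCommGroup E] [InnerProductSpace ℝ E] [Fintype ι]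
    (v : ι → E) (hneg : ∀ j k, j ≠ k → ⟪v j, v k⟫ ≤ 0) (hsum : ∀ j, 0 ≤ ⟪v j, ∑ k, v k⟫)
    (a : ι → ℝ) :
    ‖∑ j, a j • v j‖ ^ 2 ≤ 2 * ∑ j, a j ^ 2 * ‖v j‖ ^ 2 := by
  classical
  have hrow (j : ι) : ∑ k, |⟪v j, v k⟫| ≤ 2 * ‖v j‖ ^ 2 := by
    have habs (k : ι) : |⟪v j, v k⟫| = (if j = k then 2 * ‖v j‖ ^ 2 else 0) - ⟪v j, v k⟫ := by
      split_ifs with hjk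
      · subst hjk
        rw [real_inner_self_eq_norm_sq, abs_of_nonneg (by positivity)]
        ring
      · rw [abs_of_nonpos (hneg j k hjk), zero_sub]
    have hj := hsum j
    rw [inner_sum] at hj
    simp only [habs, Finset.sum_sub_distrib, Finset.sum_ite_eq, Finset.mem_univ, if_true]
    linarith
  have hterm (j k : ι) : ⟪a j • v j, a k • v k⟫ ≤
      a j ^ 2 / 2 * |⟪v j, v k⟫| + a k ^ 2 / 2 * |⟪v k, v j⟫| := by
    rw [real_inner_smul_left, real_inner_smul_right, real_inner_comm (v j) (v k)]
    have h₁ := le_abs_self (a j * a k * ⟪v j, v k⟫)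
    rw [abs_mul, abs_mul] at h₁
    have h₂ : |a j| * |a k| ≤ a j ^ 2 / 2 + a k ^ 2 / 2 := by
      rw [← sq_abs (a j), ← sq_abs (a k)]
      nlinarith [sq_nonneg (|a j| - |a k|)]
    nlinarith [mul_le_mul_of_nonneg_right h₂ (abs_nonneg ⟪v j, v k⟫)]
  calc ‖∑ j, a j • v j‖ ^ 2 = ∑ j, ∑ k, ⟪a j • v j, a k • v k⟫ := by
        rw [← real_inner_self_eq_norm_sq, sum_inner]
        simp only [inner_sum]
    _ ≤ ∑ j, ∑ k, (a j ^ 2 / 2 * |⟪v j, v k⟫| + a k ^ 2 / 2 * |⟪v k, v j⟫|) :=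
        Finset.sum_le_sum fun j _ => Finset.sum_le_sum fun k _ => hterm j k
    _ = ∑ j, a j ^ 2 * ∑ k, |⟪v j, v k⟫| := by
        simp only [Finset.sum_add_distrib]
        rw [Finset.sum_comm (f := fun j k => a k ^ 2 / 2 * |⟪v k, v j⟫|), ← Finset.sum_add_distrib]
        refine Finset.sum_congr rfl fun j _ => ?_
        rw [← Finset.mul_sum]
        ring
    _ ≤ ∑ j, a j ^ 2 * (2 * ‖v j‖ ^ 2) :=
        Finset.sum_le_sum fun j _ => mul_le_mul_of_nonneg_left (hrow j) (sq_nonneg _)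
    _ = 2 * ∑ j, a j ^ 2 * ‖v j‖ ^ 2 := by
        rw [Finset.mul_sum]
        exact Finset.sum_congr rfl fun j _ => by ring

/-- A Bessel-type inequality, with constant `2`, for vectors that are pairwise negatively
correlated, but nonnegatively correlated with their sum. -/
lemma sum_inner_sq_div_norm_sq_le {E ι : Type*} [NormedAddCommGroup E] [InnerProductSpace ℝ E]
    [Fintype ι] (v : ι → E) (hneg : ∀ j k, j ≠ k → ⟪v j, v k⟫ ≤ 0)
    (hsum : ∀ j, 0 ≤ ⟪v j, ∑ k, v k⟫) (h : E) :
    ∑ j, ⟪h, v j⟫ ^ 2 / ‖v j‖ ^ 2 ≤ 2 * ‖h‖ ^ 2 := by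
  set S := ∑ j, ⟪h, v j⟫ ^ 2 / ‖v j‖ ^ 2 with hS
  have hS₀ : 0 ≤ S := Finset.sum_nonneg fun j _ => by positivity
  set w := ∑ j, (⟪h, v j⟫ / ‖v j‖ ^ 2) • v j with hw
  have hinner : ⟪h, w⟫ = S := by
    rw [hw, hS, inner_sum]
    refine Finset.sum_congr rfl fun j _ => ?_
    rw [real_inner_smul_right]
    ring
  have hnorm : ‖w‖ ^ 2 ≤ 2 * S := by
    refine (norm_sq_sum_smul_le v hneg hsum _).trans_eq ?_
    rw [hS]
    congr 1
    refine Finset.sum_congr rfl fun j _ => ?_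
    rcases eq_or_ne (v j) 0 with hj | hj
    · simp [hj]
    · have := norm_ne_zero_iff.2 hj
      field_simp
  have hcs : S ^ 2 ≤ ‖h‖ ^ 2 * ‖w‖ ^ 2 := by
    rw [← mul_pow]
    exact pow_le_pow_left₀ hS₀ (hinner ▸ real_inner_le_norm h w) 2
  rcases hS₀.eq_or_lt with h₀ | h₀
  · rw [← h₀]
    positivity
  · nlinarith [mul_le_mul_of_nonneg_left hnorm (sq_nonneg ‖h‖)]

/-- A concave function has a larger sum at the inner pair of two pairs with the same midpoint. -/
lemma ConcaveOn.add_le_add_of_between {f : ℝ → ℝ} {s : Set ℝ} (hf : ConcaveOn ℝ s f)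
    {x y z w : ℝ} (hx : x ∈ s) (hw : w ∈ s) (hxy : x ≤ y) (hyw : y ≤ w) (hsum : x + w = y + z) :
    f x + f w ≤ f y + f z := by
  rcases (hxy.trans hyw).eq_or_lt with h | h
  · obtain rfl : y = x := by linarith
    obtain rfl : z = w := by linarith
    rfl
  · have hpos : 0 < w - x := sub_pos.2 h
    have hne : w - x ≠ 0 := hpos.ne'
    have hα : 0 ≤ (w - y) / (w - x) := div_nonneg (by linarith) hpos.le
    have hβ : 0 ≤ (y - x) / (w - x) := div_nonneg (by linarith) hpos.le
    have hαβ : (w - y) / (w - x) + (y - x) / (w - x) = 1 := by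
      field_simp
      ring
    have h₁ := hf.2 hx hw hα hβ hαβ
    have h₂ := hf.2 hx hw hβ hα (by rw [add_comm, hαβ])
    have e₁ : ((w - y) / (w - x)) • x + ((y - x) / (w - x)) • w = y := by
      simp only [smul_eq_mul]
      field_simp
      ring
    have e₂ : ((y - x) / (w - x)) • x + ((w - y) / (w - x)) • w = z := by
      obtain rfl : z = x + w - y := by linarith
      simp only [smul_eq_mul]
      field_simp
      ring
    rw [e₁] at h₁
    rw [e₂] at h₂
    simp only [smul_eq_mul] at h₁ h₂
    have h₃ : f x + f w = ((w - y) / (w - x) + (y - x) / (w - x)) * (f x + f w) := by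
      rw [hαβ, one_mul]
    linarith

section FractionalCurve

variable {E : Type*} [NormedAddCommGroup E] [InnerProductSpace ℝ E] {H : ℝ} {K : ℝ → E}

/-- Covariance of two increments of a curve with fractional covariance. -/
lemma inner_sub_sub_of_fbmCov
    (hK : ∀ s ∈ Icc (0 : ℝ) 1, ∀ t ∈ Icc (0 : ℝ) 1, ⟪K s, K t⟫ = fbmCov H s t)
    {a b c e : ℝ} (ha : a ∈ Icc (0 : ℝ) 1) (hb : b ∈ Icc (0 : ℝ) 1) (hc : c ∈ Icc (0 : ℝ) 1)
    (he : e ∈ Icc (0 : ℝ) 1) :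
    ⟪K b - K a, K e - K c⟫ = (1 / 2) *
      (|b - c| ^ (2 * H) + |a - e| ^ (2 * H) - |b - e| ^ (2 * H) - |a - c| ^ (2 * H)) := by
  rw [inner_sub_left, inner_sub_right, inner_sub_right, hK b hb e he, hK b hb c hc, hK a ha e he,
    hK a ha c hc]
  unfold fbmCov
  ring

lemma norm_sq_sub_of_fbmCov (hH : 0 < H)
    (hK : ∀ s ∈ Icc (0 : ℝ) 1, ∀ t ∈ Icc (0 : ℝ) 1, ⟪K s, K t⟫ = fbmCov H s t)
    {a b : ℝ} (ha : a ∈ Icc (0 : ℝ) 1) (hb : b ∈ Icc (0 : ℝ) 1) :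
    ‖K b - K a‖ ^ 2 = |b - a| ^ (2 * H) := by
  rw [← real_inner_self_eq_norm_sq, inner_sub_sub_of_fbmCov hK ha hb ha hb, sub_self, sub_self,
    abs_zero, zero_rpow (by positivity), abs_sub_comm a b]
  ring

/-- For `H ≤ 1/2`, increments over successive intervals are negatively correlated. -/
lemma inner_sub_sub_nonpos_of_fbmCov (hH : 0 < H) (hH' : H ≤ 1 / 2)
    (hK : ∀ s ∈ Icc (0 : ℝ) 1, ∀ t ∈ Icc (0 : ℝ) 1, ⟪K s, K t⟫ = fbmCov H s t)
    {a b c e : ℝ} (ha : a ∈ Icc (0 : ℝ) 1) (hb : b ∈ Icc (0 : ℝ) 1) (hc : c ∈ Icc (0 : ℝ) 1)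
    (he : e ∈ Icc (0 : ℝ) 1) (hab : a ≤ b) (hbc : b ≤ c) (hce : c ≤ e) :
    ⟪K b - K a, K e - K c⟫ ≤ 0 := by
  rw [inner_sub_sub_of_fbmCov hK ha hb hc he, abs_sub_comm b c, abs_sub_comm a e,
    abs_sub_comm b e, abs_sub_comm a c, abs_of_nonneg (by linarith : 0 ≤ c - b),
    abs_of_nonneg (by linarith : 0 ≤ e - a), abs_of_nonneg (by linarith : 0 ≤ e - b),
    abs_of_nonneg (by linarith : 0 ≤ c - a)]
  have := (Real.concaveOn_rpow (p := 2 * H) (by linarith) (by linarith)).add_le_add_of_between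
    (x := c - b) (y := e - b) (z := c - a) (w := e - a) (mem_Ici.2 (by linarith))
    (mem_Ici.2 (by linarith)) (by linarith) (by linarith) (by ring)
  linarith

/-- An increment is nonnegatively correlated with every increment over a larger interval. -/
lemma inner_sub_sub_nonneg_of_fbmCov (hH : 0 < H)
    (hK : ∀ s ∈ Icc (0 : ℝ) 1, ∀ t ∈ Icc (0 : ℝ) 1, ⟪K s, K t⟫ = fbmCov H s t)
    {a b c e : ℝ} (ha : a ∈ Icc (0 : ℝ) 1) (hb : b ∈ Icc (0 : ℝ) 1) (hc : c ∈ Icc (0 : ℝ) 1)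
    (he : e ∈ Icc (0 : ℝ) 1) (hca : c ≤ a) (hab : a ≤ b) (hbe : b ≤ e) :
    0 ≤ ⟪K b - K a, K e - K c⟫ := by
  rw [inner_sub_sub_of_fbmCov hK ha hb hc he, abs_sub_comm a e, abs_sub_comm b e,
    abs_of_nonneg (by linarith : 0 ≤ b - c), abs_of_nonneg (by linarith : 0 ≤ e - a),
    abs_of_nonneg (by linarith : 0 ≤ e - b), abs_of_nonneg (by linarith : 0 ≤ a - c)]
  have h₁ : (a - c) ^ (2 * H) ≤ (b - c) ^ (2 * H) :=
    rpow_le_rpow (by linarith) (by linarith) (by linarith)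
  have h₂ : (e - b) ^ (2 * H) ≤ (e - a) ^ (2 * H) :=
    rpow_le_rpow (by linarith) (by linarith) (by linarith)
  linarith

/-- The weighted quadratic variation of `t ↦ ⟪h, K t⟫` along a partition is at most `2‖h‖²`. -/
lemma sum_inner_increment_sq_div_le (hH : 0 < H) (hH' : H ≤ 1 / 2)
    (hK : ∀ s ∈ Icc (0 : ℝ) 1, ∀ t ∈ Icc (0 : ℝ) 1, ⟪K s, K t⟫ = fbmCov H s t)
    {n : ℕ} {u : Fin (n + 1) → ℝ} (hu : Monotone u) (hu' : ∀ k, u k ∈ Icc (0 : ℝ) 1) (h : E) :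
    ∑ k : Fin n, ⟪h, K (u k.succ) - K (u k.castSucc)⟫ ^ 2 /
      (u k.succ - u k.castSucc) ^ (2 * H) ≤ 2 * ‖h‖ ^ 2 := by
  have hstep (k : Fin n) : u k.castSucc ≤ u k.succ := hu k.castSucc_le_succ
  have hlt {j k : Fin n} (hjk : j < k) : ⟪K (u j.succ) - K (u j.castSucc),
      K (u k.succ) - K (u k.castSucc)⟫ ≤ 0 :=
    inner_sub_sub_nonpos_of_fbmCov hH hH' hK (hu' _) (hu' _) (hu' _) (hu' _) (hstep j)
      (hu (Fin.succ_le_castSucc_iff.2 hjk)) (hstep k)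
  have key := sum_inner_sq_div_norm_sq_le (fun k : Fin n => K (u k.succ) - K (u k.castSucc))
    (fun j k hjk => by
      rcases hjk.lt_or_gt with h' | h'
      · exact hlt h'
      · rw [real_inner_comm]
        exact hlt h')
    (fun j => by
      rw [sum_fin_succ_sub_castSucc (fun k => K (u k))]
      exact inner_sub_sub_nonneg_of_fbmCov hH hK (hu' _) (hu' _) (hu' _) (hu' _)
        (hu (Fin.zero_le _)) (hstep j) (hu (Fin.le_last _))) h
  refine le_trans (le_of_eq ?_) key
  refine Finset.sum_congr rfl fun k _ => ?_
  rw [norm_sq_sub_of_fbmCov hH hK (hu' _) (hu' _), abs_of_nonneg (sub_nonneg.2 (hstep k))]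

end FractionalCurve

/-- Hölder's inequality turns a bound on a weighted quadratic variation into a bound on the
variation of index `(H + 1/2)⁻¹`. -/
lemma sum_rpow_le_of_sum_sq_div_le {n : ℕ} {H M : ℝ} (hH : 0 < H) (hM : 0 ≤ M)
    (x w : Fin n → ℝ) (hx : ∀ k, 0 ≤ x k) (hw : ∀ k, 0 ≤ w k) (hxw : ∀ k, w k = 0 → x k = 0)
    (hw₁ : ∑ k, w k ≤ 1) (hS : ∑ k, x k ^ 2 / w k ^ (2 * H) ≤ M ^ 2) :
    ∑ k, x k ^ (H + 1 / 2)⁻¹ ≤ M ^ (H + 1 / 2)⁻¹ := by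
  set r := (H + 1 / 2)⁻¹ with hr
  have hr₀ : 0 < r := by positivity
  have hrp : r * (2 * H + 1) = 2 := by
    rw [hr]
    field_simp
  have hol := Real.inner_le_weight_mul_Lp_of_nonneg Finset.univ (p := 2 * H + 1) (by linarith) w
    (fun k => x k ^ r / w k) hw (fun k => div_nonneg (rpow_nonneg (hx k) _) (hw k))
  have e₁ (k : Fin n) : w k * (x k ^ r / w k) = x k ^ r := by
    rcases eq_or_ne (w k) 0 with h₀ | h₀
    · rw [hxw k h₀, zero_rpow hr₀.ne']
      simp
    · field_simp
  have e₂ (k : Fin n) : w k * (x k ^ r / w k) ^ (2 * H + 1) = x k ^ 2 / w k ^ (2 * H) := by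
    rcases eq_or_ne (w k) 0 with h₀ | h₀
    · rw [h₀, hxw k h₀]
      simp
    · have hpos : 0 < w k := (hw k).lt_of_ne' h₀
      rw [div_rpow (rpow_nonneg (hx k) _) (hw k), ← rpow_mul (hx k), hrp, rpow_two,
        rpow_add_one h₀]
      field_simp
  simp only [e₁, e₂] at hol
  refine hol.trans ?_
  have h₁ : (∑ k, w k) ^ (1 - (2 * H + 1)⁻¹) ≤ 1 :=
    rpow_le_one (Finset.sum_nonneg fun k _ => hw k) hw₁
      (sub_nonneg.2 (inv_le_one_of_one_le₀ (by linarith)))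
  have hS₀ : 0 ≤ ∑ k, x k ^ 2 / w k ^ (2 * H) :=
    Finset.sum_nonneg fun k _ => div_nonneg (sq_nonneg _) (rpow_nonneg (hw k) _)
  have h₂ : (∑ k, x k ^ 2 / w k ^ (2 * H)) ^ (2 * H + 1)⁻¹ ≤ M ^ r := by
    refine (rpow_le_rpow hS₀ hS (by positivity)).trans_eq ?_
    rw [← rpow_two, ← rpow_mul hM]
    congr 1
    rw [← div_eq_mul_inv, div_eq_iff (by positivity), hrp]
  calc _ ≤ 1 * M ^ r := mul_le_mul h₁ h₂ (rpow_nonneg hS₀ _) zero_le_one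
    _ = M ^ r := one_mul _

/-- Monotonicity of the `ℓ^q`-norms in `q`. -/
lemma sum_rpow_le_rpow_of_le {ι : Type*} [Fintype ι] {r q M : ℝ} (hr : 0 < r) (hrq : r ≤ q)
    (hM : 0 ≤ M) (x : ι → ℝ) (hx : ∀ k, 0 ≤ x k) (hS : ∑ k, x k ^ r ≤ M ^ r) :
    ∑ k, x k ^ q ≤ M ^ q := by
  have hxM (k : ι) : x k ≤ M :=
    (rpow_le_rpow_iff (hx k) hM hr).1 ((Finset.single_le_sum (f := fun k => x k ^ r)
      (fun j _ => rpow_nonneg (hx j) _) (Finset.mem_univ k)).trans hS)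
  have hsplit {y : ℝ} (hy : 0 ≤ y) : y ^ q = y ^ r * y ^ (q - r) := by
    rw [← rpow_add_of_nonneg hy hr.le (sub_nonneg.2 hrq), add_sub_cancel]
  calc ∑ k, x k ^ q ≤ ∑ k, x k ^ r * M ^ (q - r) := Finset.sum_le_sum fun k _ => by
        rw [hsplit (hx k)]
        exact mul_le_mul_of_nonneg_left (rpow_le_rpow (hx k) (hxM k) (sub_nonneg.2 hrq))
          (rpow_nonneg (hx k) _)
    _ = (∑ k, x k ^ r) * M ^ (q - r) := by rw [Finset.sum_mul]
    _ ≤ M ^ r * M ^ (q - r) := mul_le_mul_of_nonneg_right hS (rpow_nonneg hM _)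
    _ = M ^ q := (hsplit hM).symm

/-- variational embedding of the Cameron–Martin space.
The Cameron–Martin space `H̄` of a `d`-dimensional fBm with Hurst parameter `H ∈ (0,1)`
is modelled as a Hilbert space `Hbar` of paths `[0,1] → ℝ^d` (via `toPath`), with
reproducing kernel elements `kernel t i` representing `R(t,·)eᵢ`: their Gram matrix is
the fBm covariance, point evaluation is given by the inner product against them, and
their span is dense.
Conclusion: if `H > 1/2` then `H̄ ⊆ C₀^H([0,1];ℝ^d)` continuously (Hölder bound
`‖h_t - h_s‖ ≤ C‖h‖_{H̄} |t-s|^H`); if `H ≤ 1/2` then for every `q > (H+1/2)⁻¹`,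
`H̄ ⊆ C₀^{q-var}([0,1];ℝ^d)` continuously (all partition sums satisfy
`∑ ‖h_{t_{k+1}} - h_{t_k}‖^q ≤ (C‖h‖_{H̄})^q`). -/
theorem cameronMartin_variational_embedding
    (d : ℕ) (H : ℝ) (hH : H ∈ Set.Ioo (0 : ℝ) 1)
    (Hbar : Type*) [NormedAddCommGroup Hbar] [InnerProductSpace ℝ Hbar]
    (toPath : Hbar →ₗ[ℝ] (ℝ → EuclideanSpace ℝ (Fin d)))
    (kernel : ℝ → Fin d → Hbar)
    (hker : ∀ s ∈ Set.Icc (0 : ℝ) 1, ∀ t ∈ Set.Icc (0 : ℝ) 1, ∀ i j,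
      ⟪kernel s i, kernel t j⟫ = if i = j then fbmCov H s t else 0)
    (hrep : ∀ (h : Hbar), ∀ t ∈ Set.Icc (0 : ℝ) 1, ∀ i, toPath h t i = ⟪h, kernel t i⟫)
    (hdense : Dense (↑(Submodule.span ℝ
      {v : Hbar | ∃ t ∈ Set.Icc (0 : ℝ) 1, ∃ i, v = kernel t i}) : Set Hbar)) :
    ((1 : ℝ) / 2 < H →
      ∃ C : ℝ, 0 < C ∧ ∀ h : Hbar,
        toPath h 0 = 0 ∧
        ∀ s ∈ Set.Icc (0 : ℝ) 1, ∀ t ∈ Set.Icc (0 : ℝ) 1,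
          ‖toPath h t - toPath h s‖ ≤ C * ‖h‖ * |t - s| ^ H) ∧
    (H ≤ (1 : ℝ) / 2 →
      ∀ q : ℝ, (H + 1 / 2)⁻¹ < q →
        ∃ C : ℝ, 0 < C ∧ ∀ h : Hbar,
          toPath h 0 = 0 ∧
          ContinuousOn (toPath h) (Set.Icc (0 : ℝ) 1) ∧
          ∀ (n : ℕ) (u : Fin (n + 1) → ℝ), Monotone u → (∀ k, u k ∈ Set.Icc (0 : ℝ) 1) →
            ∑ k : Fin n, ‖toPath h (u k.succ) - toPath h (u k.castSucc)‖ ^ q ≤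
              (C * ‖h‖) ^ q) := by
  have hH₀ : 0 < H := hH.1
  have hK (i : Fin d) : ∀ s ∈ Icc (0 : ℝ) 1, ∀ t ∈ Icc (0 : ℝ) 1,
      ⟪kernel s i, kernel t i⟫ = fbmCov H s t := fun s hs t ht => by
    rw [hker s hs t ht, if_pos rfl]
  have hnormsq (h : Hbar) {s t : ℝ} (hs : s ∈ Icc (0 : ℝ) 1) (ht : t ∈ Icc (0 : ℝ) 1) :
      ‖toPath h t - toPath h s‖ ^ 2 = ∑ i, ⟪h, kernel t i - kernel s i⟫ ^ 2 := by
    rw [EuclideanSpace.real_norm_sq_eq]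
    refine Finset.sum_congr rfl fun i _ => ?_
    rw [PiLp.sub_apply, hrep h t ht, hrep h s hs, inner_sub_right]
  have hzero (h : Hbar) : toPath h 0 = 0 := by
    ext i
    have h0 : (0 : ℝ) ∈ Icc (0 : ℝ) 1 := ⟨le_rfl, zero_le_one⟩
    have hk : kernel 0 i = 0 := by
      rw [← inner_self_eq_zero (𝕜 := ℝ), hK i 0 h0 0 h0, fbmCov, sub_self, abs_zero,
        zero_rpow (by positivity)]
      simp
    rw [hrep h 0 h0, hk, inner_zero_right, PiLp.zero_apply]
  have hholder (h : Hbar) {s t : ℝ} (hs : s ∈ Icc (0 : ℝ) 1) (ht : t ∈ Icc (0 : ℝ) 1) :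
      ‖toPath h t - toPath h s‖ ≤ √(d + 1) * ‖h‖ * |t - s| ^ H := by
    refine (sq_le_sq₀ (norm_nonneg _) (by positivity)).1 ?_
    have hterm (i : Fin d) : ⟪h, kernel t i - kernel s i⟫ ^ 2 ≤ ‖h‖ ^ 2 * |t - s| ^ (2 * H) := by
      rw [← norm_sq_sub_of_fbmCov hH₀ (hK i) hs ht, ← mul_pow]
      exact sq_le_sq' (neg_le_of_abs_le (abs_real_inner_le_norm _ _)) (real_inner_le_norm _ _)
    have hpow : (|t - s| ^ H) ^ 2 = |t - s| ^ (2 * H) := by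
      rw [← rpow_two, ← rpow_mul (abs_nonneg _), mul_comm]
    rw [hnormsq h hs ht, mul_pow, mul_pow, sq_sqrt (by positivity), hpow, mul_assoc]
    refine (Finset.sum_le_sum fun i _ => hterm i).trans ?_
    rw [Finset.sum_const, Finset.card_univ, Fintype.card_fin, nsmul_eq_mul]
    exact mul_le_mul_of_nonneg_right (by linarith) (by positivity)
  refine ⟨fun _ => ⟨√(d + 1), by positivity, fun h => ⟨hzero h, fun s hs t ht =>
    hholder h hs ht⟩⟩, fun hH' q hq => ⟨√(2 * d + 1), by positivity, fun h =>
    ⟨hzero h, ?_, fun n u hu hu' => ?_⟩⟩⟩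
  · intro s hs
    refine tendsto_iff_norm_sub_tendsto_zero.2 ?_
    have hlim : Filter.Tendsto (fun t => √(d + 1) * ‖h‖ * |t - s| ^ H)
        (nhdsWithin s (Icc 0 1)) (nhds 0) := by
      have hc : Continuous fun t : ℝ => √(d + 1) * ‖h‖ * |t - s| ^ H :=
        continuous_const.mul
          ((continuous_id.sub continuous_const).abs.rpow_const fun _ => Or.inr hH₀.le)
      have := hc.tendsto s
      rw [sub_self, abs_zero, zero_rpow hH₀.ne', mul_zero] at this
      exact this.mono_left nhdsWithin_le_nhds
    refine squeeze_zero' (Filter.Eventually.of_forall fun t => norm_nonneg _) ?_ hlim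
    filter_upwards [self_mem_nhdsWithin] with t ht using hholder h hs ht
  · refine sum_rpow_le_rpow_of_le (by positivity) hq.le (by positivity) _
      (fun k => norm_nonneg _) ?_
    refine sum_rpow_le_of_sum_sq_div_le hH₀ (by positivity) _
      (fun k => u k.succ - u k.castSucc) (fun k => norm_nonneg _)
      (fun k => sub_nonneg.2 (hu k.castSucc_le_succ)) (fun k hk => ?_) ?_ ?_
    · rw [sub_eq_zero.1 hk, sub_self, norm_zero]
    · rw [sum_fin_succ_sub_castSucc u]
      linarith [(hu' (Fin.last n)).2, (hu' 0).1]
    · simp only [hnormsq h (hu' _) (hu' _), Finset.sum_div]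
      rw [Finset.sum_comm, mul_pow, sq_sqrt (by positivity)]
      refine (Finset.sum_le_sum fun i _ =>
        sum_inner_increment_sq_div_le hH₀ hH' (hK i) hu hu' h).trans ?_
      rw [Finset.sum_const, Finset.card_univ, Fintype.card_fin, nsmul_eq_mul]
      nlinarith [sq_nonneg ‖h‖]
end
end

section
/- Let H < 1/2. The set of functions on [0,1] of the form t ↦ (1−t)^{1/2−H} p(t), where p is a polynomial, is dense in L²([0,1]). -/
open MeasureTheory Real Set

open scoped ENNReal NNReal

/-- Polynomials approximate every `L^q` function, `1 ≤ q < ∞`, with respect to a finite measure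
carried by a compact interval. -/
theorem exists_polynomial_eLpNorm_sub_le {ν : Measure ℝ} [IsFiniteMeasure ν] {a b : ℝ}
    (hν : ∀ᵐ x ∂ν, x ∈ Icc a b) {q : ℝ≥0∞} (hq1 : 1 ≤ q) (hq : q ≠ ∞) {f : ℝ → ℝ}
    (hf : MemLp f q ν) {ε : ℝ≥0∞} (hε : ε ≠ 0) :
    ∃ p : Polynomial ℝ, eLpNorm (fun x => f x - p.eval x) q ν ≤ ε := by
  have hε2 : ε / 2 ≠ 0 := by simpa using hε
  obtain ⟨g, hfg, hg⟩ := hf.exists_boundedContinuous_eLpNorm_sub_le hq hε2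
  have hfin : ν univ ^ q.toReal⁻¹ ≠ ∞ :=
    ENNReal.rpow_ne_top_of_nonneg (by positivity) (measure_ne_top ν univ)
  obtain ⟨δ, hδ, hδε⟩ := ENNReal.exists_nnreal_pos_mul_lt hfin hε2
  obtain ⟨p, hp⟩ := exists_polynomial_near_of_continuousOn a b g g.continuous.continuousOn δ
    (by exact_mod_cast hδ)
  refine ⟨p, ?_⟩
  have hgp : eLpNorm (fun x => g x - p.eval x) q ν ≤ ε / 2 := by
    refine (eLpNorm_le_of_ae_bound (C := δ) ?_).trans ?_
    · filter_upwards [hν] with x hx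
      rw [Real.norm_eq_abs, abs_sub_comm]
      exact (hp x hx).le
    · rw [ENNReal.ofReal_coe_nnreal, mul_comm]
      exact hδε.le
  calc eLpNorm (fun x => f x - p.eval x) q ν
      = eLpNorm ((f - (g : ℝ → ℝ)) + fun x => g x - p.eval x) q ν := by
        congr 1; ext x; simp
    _ ≤ eLpNorm (f - (g : ℝ → ℝ)) q ν + eLpNorm (fun x => g x - p.eval x) q ν :=
        eLpNorm_add_le (hf.sub hg).1
          (g.continuous.sub p.continuous).aestronglyMeasurable hq1
    _ ≤ ε / 2 + ε / 2 := add_le_add hfg hgp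
    _ = ε := ENNReal.add_halves ε

/-- The `L²` seminorm for the density `|w|²` is the `L²` seminorm after multiplication by `w`. -/
theorem eLpNorm_two_withDensity_enorm_sq {α : Type*} [MeasurableSpace α] {μ : Measure α}
    {w : α → ℝ} (hw : AEMeasurable w μ) (g : α → ℝ) :
    eLpNorm g 2 (μ.withDensity fun x => ‖w x‖ₑ ^ (2 : ℝ)) = eLpNorm (fun x => w x * g x) 2 μ := by
  rw [eLpNorm_eq_lintegral_rpow_enorm_toReal two_ne_zero ENNReal.ofNat_ne_top,
    eLpNorm_eq_lintegral_rpow_enorm_toReal two_ne_zero ENNReal.ofNat_ne_top,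
    lintegral_withDensity_eq_lintegral_mul_non_measurable₀ μ (hw.enorm.pow_const _)
      (.of_forall fun x => ENNReal.rpow_lt_top_of_nonneg zero_le_two enorm_ne_top)]
  simp [enorm_mul, mul_pow]

/-- If `w ∈ L²(μ)` is almost everywhere nonzero and `μ` is carried by a compact interval, then the
functions `w * p`, with `p` a polynomial, approximate every function in `L²(μ)`. -/
theorem exists_polynomial_eLpNorm_sub_mul_le {μ : Measure ℝ} {a b : ℝ}
    (hμ : ∀ᵐ x ∂μ, x ∈ Icc a b) {w : ℝ → ℝ} (hw : MemLp w 2 μ) (hw0 : ∀ᵐ x ∂μ, w x ≠ 0)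
    {f : ℝ → ℝ} (hf : MemLp f 2 μ) {ε : ℝ≥0∞} (hε : ε ≠ 0) :
    ∃ p : Polynomial ℝ, eLpNorm (fun x => f x - w x * p.eval x) 2 μ ≤ ε := by
  have hac := withDensity_absolutelyContinuous μ fun x => ‖w x‖ₑ ^ (2 : ℝ)
  have : IsFiniteMeasure (μ.withDensity fun x => ‖w x‖ₑ ^ (2 : ℝ)) :=
    isFiniteMeasure_withDensity (by
      simpa using (lintegral_rpow_enorm_lt_top_of_eLpNorm_lt_top two_ne_zero
        ENNReal.ofNat_ne_top hw.2).ne)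
  have hwm := hw.1.aemeasurable
  have hquot : MemLp (fun x => f x / w x) 2 (μ.withDensity fun x => ‖w x‖ₑ ^ (2 : ℝ)) := by
    refine ⟨((hf.1.aemeasurable.div hwm).mono_ac hac).aestronglyMeasurable, ?_⟩
    rw [eLpNorm_two_withDensity_enorm_sq hwm]
    refine (eLpNorm_congr_ae ?_).trans_lt hf.2
    filter_upwards [hw0] with x hx
    field_simp
  obtain ⟨p, hp⟩ := exists_polynomial_eLpNorm_sub_le (hac.ae_le hμ) one_le_two
    ENNReal.ofNat_ne_top hquot hε
  refine ⟨p, le_of_eq_of_le (eLpNorm_congr_ae ?_)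
    ((eLpNorm_two_withDensity_enorm_sq hwm _).symm.trans_le hp)⟩
  filter_upwards [hw0] with x hx
  field_simp

/-- For `H < 1/2`, the set of functions on `[0,1]` of the form
`t ↦ (1-t)^(1/2-H) p(t)`, with `p` a polynomial, is dense in `L²([0,1])`. -/
theorem polynomial_times_power_dense_in_L2
    (H : ℝ) (hH : H ∈ Set.Ioo (0 : ℝ) (1 / 2)) :
    Dense {f : Lp ℝ 2 (volume.restrict (Icc (0 : ℝ) 1)) |
      ∃ p : Polynomial ℝ,
        ∀ᵐ t ∂(volume.restrict (Icc (0 : ℝ) 1)),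
          f t = (1 - t) ^ ((1 : ℝ) / 2 - H) * p.eval t} := by
  have hcont : Continuous fun t : ℝ => (1 - t) ^ ((1 : ℝ) / 2 - H) :=
    (continuous_const.sub continuous_id).rpow_const fun _ => Or.inr (sub_pos.2 hH.2).le
  have hIcc : ∀ᵐ t ∂(volume.restrict (Icc (0 : ℝ) 1)), t ∈ Icc (0 : ℝ) 1 :=
    ae_restrict_mem measurableSet_Icc
  have hmem {g : ℝ → ℝ} (hg : Continuous g) : MemLp g 2 (volume.restrict (Icc (0 : ℝ) 1)) := by
    obtain ⟨C, hC⟩ := isCompact_Icc.exists_bound_of_continuousOn hg.continuousOn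
    exact .of_bound hg.aestronglyMeasurable C (hIcc.mono hC)
  have hne : ∀ᵐ t ∂(volume.restrict (Icc (0 : ℝ) 1)), (1 - t) ^ ((1 : ℝ) / 2 - H) ≠ 0 := by
    filter_upwards [hIcc, Measure.ae_ne (volume.restrict (Icc (0 : ℝ) 1)) 1] with t ht ht1
    exact (rpow_pos_of_pos (sub_pos.2 (lt_of_le_of_ne ht.2 ht1)) _).ne'
  intro f
  refine EMetric.mem_closure_iff.2 fun ε hε => ?_
  obtain ⟨ε', hε', hε'ε⟩ := exists_between hε
  obtain ⟨p, hp⟩ := exists_polynomial_eLpNorm_sub_mul_le hIcc (hmem hcont) hne (Lp.memLp f)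
    hε'.ne'
  have hwp := hmem (hcont.mul p.continuous)
  refine ⟨hwp.toLp _, ⟨p, hwp.coeFn_toLp⟩, lt_of_le_of_lt ?_ hε'ε⟩
  rw [Lp.edist_def]
  refine le_of_eq_of_le (eLpNorm_congr_ae ?_) hp
  filter_upwards [hwp.coeFn_toLp] with t ht
  rw [Pi.sub_apply, ht, Pi.mul_apply]
end
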